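/- Let k ≥ 1 and let f_1,…,f_k and g_1,…,g_{k+1} be nonzero homogeneous polynomials in ℂ[x_0,…,x_{k+3}] of positive degrees, with deg f_1 ≤ … ≤ deg f_k and deg g_1 ≤ … ≤ deg g_{k+1}. Assume: (i) ⟨f_1,…,f_k⟩ ⊆ ⟨g_1,…,g_{k+1}⟩; (ii) the projective variety X = V(f_1,…,f_k) has dimension 3 and only finitely many singular points; (iii) S = V(g_1,…,g_{k+1}) is a smooth surface, i.e. has dimension 2 and the Jacobian matrix of (g_1,…,g_{k+1}) has rank k+1 at every nonzero point of the affine cone over S; (iv) for every s ≤ k−1 the variety V(f_1,…,f_s) is smooth in codimension 3. If deg f_i < deg g_{i+1} for some integer i ≤ k, then (deg f_1,…,deg f_i) = (deg g_1,…,deg g_i). -/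

import Mathlib

noncomputable section
open MvPolynomial

/-- The Jacobian matrix of the family `p 1, …, p m` of polynomials in the variables
`x_0, …, x_n`, evaluated at the point `x` of the affine cone `ℂ^{n+1}`. -/
def jacobianAt (n m : ℕ) (p : ℕ → MvPolynomial (Fin (n + 1)) ℂ) (x : Fin (n + 1) → ℂ) :
    Matrix (Fin m) (Fin (n + 1)) ℂ :=
  Matrix.of fun l j => eval x (pderiv j (p (l.1 + 1)))

/-- `x` is a nonzero point of the affine cone over `V(p_1,…,p_m)` at which the
Jacobian matrix has rank `< m`; i.e. `x` represents a singular point of `V(p_1,…,p_m)`. -/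
def SingularConePt (n m : ℕ) (p : ℕ → MvPolynomial (Fin (n + 1)) ℂ)
    (x : Fin (n + 1) → ℂ) : Prop :=
  x ≠ 0 ∧ (∀ l, 1 ≤ l → l ≤ m → eval x (p l) = 0) ∧ (jacobianAt n m p x).rank < m

/-- The set of singular points of `V(p_1,…,p_m)` in projective space `P^n(ℂ)`. -/
def projSingularLocus (n m : ℕ) (p : ℕ → MvPolynomial (Fin (n + 1)) ℂ) :
    Set (Projectivization ℂ (Fin (n + 1) → ℂ)) :=
  {P | ∃ x, ∃ hx : x ≠ 0, SingularConePt n m p x ∧ P = Projectivization.mk ℂ x hx}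

/-- The ideal generated by `p_1,…,p_m` together with all `m × m` minors of the
Jacobian matrix; its projective zero locus is the singular locus of `V(p_1,…,p_m)`. -/
def singularIdeal (n m : ℕ) (p : ℕ → MvPolynomial (Fin (n + 1)) ℂ) :
    Ideal (MvPolynomial (Fin (n + 1)) ℂ) :=
  Ideal.span ((fun i => p i) '' Set.Icc 1 m ∪
    {q | ∃ c : Fin m → Fin (n + 1),
      q = (Matrix.of fun l l' : Fin m => pderiv (c l') (p (l.1 + 1))).det})

/-- `V(p_1,…,p_m) ⊂ P^n(ℂ)` is smooth in codimension 3: its singular locus, as a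
projective algebraic set, has dimension at most `dim V(p_1,…,p_m) − 4`.  This is
expressed via Krull dimensions of the homogeneous coordinate rings (the projective
dimension being the Krull dimension of the affine cone minus 1). -/
def SmoothInCodimThree (n m : ℕ) (p : ℕ → MvPolynomial (Fin (n + 1)) ℂ) : Prop :=
  ringKrullDim (MvPolynomial (Fin (n + 1)) ℂ ⧸ singularIdeal n m p) + 4 ≤
    ringKrullDim (MvPolynomial (Fin (n + 1)) ℂ ⧸
      Ideal.span ((fun i => p i) '' Set.Icc 1 m))

theorem ringKrullDim_le_of_isIntegral {R S : Type*} [CommRing R] [CommRing S] [Algebra R S]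
    [Algebra.IsIntegral R S] : ringKrullDim S ≤ ringKrullDim R :=
  Order.krullDim_le_of_strictMono (PrimeSpectrum.comap (algebraMap R S)) fun _ _ h =>
    Ideal.IsIntegral.comap_lt_comap h

namespace MvPolynomial

section Graded
variable {σ R : Type*} [CommRing R]

theorem homogeneousComponent_mul_of_isHomogeneous {e : ℕ} {g : MvPolynomial σ R}
    (hg : g.IsHomogeneous e) (d : ℕ) (a : MvPolynomial σ R) :
    homogeneousComponent d (a * g) =
      if e ≤ d then homogeneousComponent (d - e) a * g else 0 := by
  conv_lhs => rw [← sum_homogeneousComponent a, Finset.sum_mul, map_sum]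
  have key : ∀ n, homogeneousComponent d (homogeneousComponent n a * g) =
      if d = n + e then homogeneousComponent n a * g else 0 := fun n =>
    homogeneousComponent_of_mem ((homogeneousComponent_isHomogeneous n a).mul hg)
  simp only [key]
  split_ifs with h
  · rw [Finset.sum_eq_single (d - e)]
    · rw [if_pos (by omega)]
    · intro n _ hn
      rw [if_neg (by omega)]
    · intro hn
      rw [homogeneousComponent_eq_zero _ _ (by simp at hn; omega), zero_mul, ite_self]
  · exact Finset.sum_eq_zero fun n _ => if_neg (by omega)

theorem IsHomogeneous.eval_smul {p : MvPolynomial σ R} {d : ℕ} (hp : p.IsHomogeneous d) (t : R)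
    (x : σ → R) : eval (t • x) p = t ^ d * eval x p := by
  rw [eval_eq, eval_eq, Finset.mul_sum]
  refine Finset.sum_congr rfl fun m hm => ?_
  have hd : m.degree = d := by
    by_contra h
    exact mem_support_iff.mp hm (hp.coeff_eq_zero h)
  simp only [Pi.smul_apply, smul_eq_mul, mul_pow, Finset.prod_mul_distrib,
    Finset.prod_pow_eq_pow_sum, ← hd, Finsupp.degree_apply]
  ring

theorem IsHomogeneous.exists_isHomogeneous_coeff {ι : Type*} [Fintype ι] {p : MvPolynomial σ R}
    {d : ℕ} (hp : p.IsHomogeneous d) {g : ι → MvPolynomial σ R} {e : ι → ℕ}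
    (hg : ∀ j, (g j).IsHomogeneous (e j)) (h : p ∈ Ideal.span (Set.range g)) :
    ∃ c : ι → MvPolynomial σ R, p = ∑ j, c j * g j ∧
      ∀ j, c j = 0 ∨ ∃ m, m + e j = d ∧ (c j).IsHomogeneous m := by
  obtain ⟨a, rfl⟩ := Ideal.mem_span_range_iff_exists_fun.mp h
  refine ⟨fun j => if e j ≤ d then homogeneousComponent (d - e j) (a j) else 0, ?_, fun j => ?_⟩
  · conv_lhs => rw [← homogeneousComponent_eq_self hp, map_sum]
    refine Finset.sum_congr rfl fun j _ => ?_
    rw [homogeneousComponent_mul_of_isHomogeneous (hg j), ite_mul, zero_mul]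
  · dsimp only
    split_ifs with h
    · exact Or.inr ⟨d - e j, by omega, homogeneousComponent_isHomogeneous _ _⟩
    · exact Or.inl rfl

theorem mem_idealOfVars_iff {p : MvPolynomial σ R} :
    p ∈ idealOfVars σ R ↔ constantCoeff p = 0 := by
  rw [← pow_one (idealOfVars σ R), mem_pow_idealOfVars_iff']
  simp [constantCoeff_eq, Finsupp.degree_eq_zero_iff]

theorem IsHomogeneous.mem_idealOfVars {p : MvPolynomial σ R} {d : ℕ}
    (hp : p.IsHomogeneous d) (hd : 0 < d) : p ∈ idealOfVars σ R := by
  rw [mem_idealOfVars_iff, constantCoeff_eq]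
  exact hp.coeff_eq_zero (by simpa using hd.ne)

end Graded

section Field
variable {σ K : Type*} [Field K]

theorem idealOfVars_eq_vanishingIdeal : idealOfVars σ K = vanishingIdeal K {(0 : σ → K)} := by
  ext p
  rw [mem_idealOfVars_iff, mem_vanishingIdeal_singleton_iff]
  rw [aeval_zero]
  simp

instance idealOfVars_isMaximal : (idealOfVars σ K).IsMaximal := by
  rw [idealOfVars_eq_vanishingIdeal]; infer_instance

theorem height_idealOfVars [Finite σ] [IsAlgClosed K] :
    (idealOfVars σ K).height = Nat.card σ := by
  have hd : ringKrullDim (MvPolynomial σ K) = Nat.card σ := by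
    rw [ringKrullDim_of_isNoetherianRing, ringKrullDim_eq_zero_of_field, zero_add]
  apply le_antisymm
  · have := Ideal.height_le_ringKrullDim_of_ne_top (I := idealOfVars σ K) Ideal.IsPrime.ne_top'
    rw [hd] at this
    exact_mod_cast this
  · have : ringKrullDim (MvPolynomial σ K) ≤ (idealOfVars σ K).height := by
      refine (ringKrullDim_le_iff_isMaximal_height_le _).mpr fun M hM => ?_
      obtain ⟨x, rfl⟩ := eq_vanishingIdeal_singleton_of_isMaximal K hM
      let e : MvPolynomial σ K ≃ₐ[K] MvPolynomial σ K :=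
        AlgEquiv.ofAlgHom (aeval fun i => X i + C (x i)) (aeval fun i => X i - C (x i))
          (by ext i; simp) (by ext i; simp)
      have he : (vanishingIdeal K {x}).comap e.symm.toRingEquiv = idealOfVars σ K := by
        ext p
        have : (aeval x).comp e.symm.toAlgHom = aeval (0 : σ → K) := by
          ext i; simp [e]
        rw [idealOfVars_eq_vanishingIdeal, mem_vanishingIdeal_singleton_iff, ← this]
        exact Ideal.mem_comap.trans (mem_vanishingIdeal_singleton_iff _ _)
      rw [← he, RingEquiv.height_comap]
    rw [hd] at this
    exact_mod_cast this

theorem idealOfVars_le_radical [Finite σ] [IsAlgClosed K] {I : Ideal (MvPolynomial σ K)}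
    (h : ∀ x, (∀ p ∈ I, eval x p = 0) → x = 0) : idealOfVars σ K ≤ I.radical := by
  rw [idealOfVars_eq_vanishingIdeal, ← vanishingIdeal_zeroLocus_eq_radical (K := K)]
  apply vanishingIdeal_anti_mono
  intro x hx
  exact h x fun p hp => by simpa using hx p hp

theorem ringKrullDim_quotient_nonpos {I : Ideal (MvPolynomial σ K)}
    (h : idealOfVars σ K ≤ I.radical) : ringKrullDim (MvPolynomial σ K ⧸ I) ≤ 0 := by
  rw [ringKrullDim_quotient, Order.krullDim_nonpos_iff_forall_isMax]
  intro P Q hPQ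
  have hP : idealOfVars σ K ≤ P.1.asIdeal :=
    h.trans (P.1.2.radical_le_iff.mpr P.2)
  have := (idealOfVars_isMaximal (σ := σ) (K := K)).eq_of_le P.1.2.ne_top hP
  have h2 := (idealOfVars_isMaximal (σ := σ) (K := K)).eq_of_le Q.1.2.ne_top (hP.trans hPQ)
  exact (h2.symm.trans this).le

/-- Homogeneous prime avoidance by linear forms. -/
theorem exists_linearForm_notMem [Infinite K] {T : Set (Ideal (MvPolynomial σ K))} (hT : T.Finite)
    (h : ∀ P ∈ T, ¬ idealOfVars σ K ≤ P) :
    ∃ l : MvPolynomial σ K, l.IsHomogeneous 1 ∧ ∀ P ∈ T, l ∉ P := by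
  let S : Set (Subspace K (homogeneousSubmodule σ K 1)) :=
    (fun P => (P.restrictScalars K).comap (homogeneousSubmodule σ K 1).subtype) '' T
  have hS : S.Finite := hT.image _
  have := Subspace.biUnion_ne_univ_of_top_notMem (s := hS.toFinset) (by
    simp only [Set.Finite.mem_toFinset]
    rintro ⟨P, hP, hPt⟩
    refine h P hP ?_
    rw [idealOfVars, Ideal.span_le]
    rintro _ ⟨i, rfl⟩
    have : (⟨X i, isHomogeneous_X K i⟩ : homogeneousSubmodule σ K 1) ∈
      (P.restrictScalars K).comap (homogeneousSubmodule σ K 1).subtype := by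
        simp only at hPt
        rw [hPt]
        trivial
    exact this)
  obtain ⟨l, hl⟩ := (Set.ne_univ_iff_exists_notMem _).mp this
  refine ⟨l, l.2, fun P hP hlP => hl ?_⟩
  simp only [Set.mem_iUnion]
  exact ⟨_, by simpa using ⟨P, hP, rfl⟩, hlP⟩

theorem exists_linearForm_ringKrullDim_quotient_le [Finite σ] [Infinite K]
    {I : Ideal (MvPolynomial σ K)} {d : ℕ}
    (h : ringKrullDim (MvPolynomial σ K ⧸ I) ≤ (d + 1 : ℕ)) :
    ∃ l : MvPolynomial σ K, l.IsHomogeneous 1 ∧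
      ringKrullDim (MvPolynomial σ K ⧸ I ⊔ Ideal.span {l}) ≤ d := by
  obtain ⟨l, hl, hlT⟩ := exists_linearForm_notMem
    (T := {P | P ∈ I.minimalPrimes ∧ ¬ idealOfVars σ K ≤ P})
    ((Ideal.finite_minimalPrimes_of_isNoetherianRing _ I).subset fun _ hP => hP.1)
    fun _ hP => hP.2
  refine ⟨l, hl, ?_⟩
  rw [ringKrullDim_quotient] at h ⊢
  refine iSup_le fun p => ?_
  have hI : I ≤ p.head.1.asIdeal := le_sup_left.trans p.head.2
  obtain ⟨Q, hQ, hQp⟩ := Ideal.exists_minimalPrimes_le hI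
  by_cases hm : idealOfVars σ K ≤ Q
  · have hmax : IsMax p.head := fun P hP => by
      have := idealOfVars_isMaximal.eq_of_le P.1.2.ne_top ((hm.trans hQp).trans hP)
      exact this.symm.le.trans (hm.trans hQp)
    have : p.length = 0 := by
      by_contra h0
      exact hmax.not_lt (p.strictMono (show 0 < Fin.last _ by
        rw [Fin.lt_def]; exact Nat.pos_of_ne_zero h0))
    simp [this]
  · have hlt : Q < p.head.1.asIdeal := hQp.lt_of_ne fun hQ' =>
      hlT Q ⟨hQ, hm⟩ (hQ' ▸ p.head.2 (Ideal.mem_sup_right (Ideal.mem_span_singleton_self l)))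
    let q : LTSeries (PrimeSpectrum.zeroLocus (I : Set (MvPolynomial σ K))) :=
      p.map (fun P => ⟨P.1, (le_sup_left.trans P.2 : I ≤ P.1.asIdeal)⟩) fun _ _ h => h
    let r : LTSeries _ := q.cons ⟨⟨Q, hQ.1.1⟩, hQ.1.2⟩ hlt
    have hrl : r.length = p.length + 1 := RelSeries.cons_length _ _ _
    have hr : ((p.length + 1 : ℕ) : WithBot ℕ∞) ≤ (d + 1 : ℕ) :=
      hrl ▸ (le_iSup (fun p : LTSeries _ => (p.length : WithBot ℕ∞)) r).trans h
    have : p.length + 1 ≤ d + 1 := by exact_mod_cast hr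
    exact_mod_cast (by omega : p.length ≤ d)

theorem exists_linearForms_ringKrullDim_quotient_nonpos [Finite σ] [Infinite K] {d : ℕ}
    {I : Ideal (MvPolynomial σ K)} (h : ringKrullDim (MvPolynomial σ K ⧸ I) ≤ d) :
    ∃ l : Fin d → MvPolynomial σ K, (∀ j, (l j).IsHomogeneous 1) ∧
      ringKrullDim (MvPolynomial σ K ⧸ I ⊔ Ideal.span (Set.range l)) ≤ 0 := by
  induction d generalizing I with
  | zero =>
    refine ⟨Fin.elim0, fun j => j.elim0, ?_⟩
    rw [Set.range_eq_empty, Ideal.span_empty, sup_bot_eq]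
    exact_mod_cast h
  | succ d ih =>
    obtain ⟨l, hl, hd⟩ := exists_linearForm_ringKrullDim_quotient_le h
    obtain ⟨l', hl', hd'⟩ := ih hd
    refine ⟨Fin.cons l l', Fin.cases hl hl', ?_⟩
    rwa [Fin.range_cons, Ideal.span_insert, ← sup_assoc]

theorem idealOfVars_le_radical_of_ringKrullDim_nonpos [Finite σ] [IsAlgClosed K]
    {s : Set (MvPolynomial σ K)} (hs : ∀ p ∈ s, ∃ d, 0 < d ∧ p.IsHomogeneous d)
    (h : ringKrullDim (MvPolynomial σ K ⧸ Ideal.span s) ≤ 0) :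
    idealOfVars σ K ≤ (Ideal.span s).radical := by
  refine idealOfVars_le_radical fun x hx => ?_
  by_contra hx0
  have : Infinite K := IsAlgClosed.instInfinite
  obtain ⟨i, hi⟩ := Function.ne_iff.mp hx0
  let φ : MvPolynomial σ K →ₐ[K] Polynomial K := aeval fun i => Polynomial.C (x i) * Polynomial.X
  have hφ : ∀ p t, (φ p).eval t = eval (t • x) p := fun p t => by
    have : ((Polynomial.aeval t).comp φ) = aeval (t • x) := by
      ext i
      simp only [AlgHom.comp_apply, φ, aeval_X, map_mul, Polynomial.aeval_C, Polynomial.aeval_X,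
        Pi.smul_apply, smul_eq_mul, Algebra.algebraMap_self_apply]
      ring
    rw [← Polynomial.coe_aeval_eq_eval]
    exact DFunLike.congr_fun this p
  rw [ringKrullDim_quotient, Order.krullDim_nonpos_iff_forall_isMax] at h
  have hsP : Ideal.span s ≤ RingHom.ker φ := Ideal.span_le.mpr fun p hp => by
    obtain ⟨d, -, hd⟩ := hs p hp
    refine Polynomial.funext fun t => ?_
    rw [hφ]
    rw [hd.eval_smul, hx p (Ideal.subset_span hp)]
    simp
  have hsm : Ideal.span s ≤ idealOfVars σ K := Ideal.span_le.mpr fun p hp => by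
    obtain ⟨d, hd0, hd⟩ := hs p hp
    exact hd.mem_idealOfVars hd0
  have hPm : RingHom.ker φ ≤ idealOfVars σ K := fun p hp => by
    have := hφ p 0
    rw [(hp : φ p = 0)] at this
    rw [mem_idealOfVars_iff]
    simpa using this.symm
  have hmP := h ⟨⟨RingHom.ker φ, RingHom.ker_isPrime φ⟩, hsP⟩
    (b := ⟨⟨idealOfVars σ K, inferInstance⟩, hsm⟩) hPm
  have hX : X i ∈ idealOfVars σ K := Ideal.subset_span ⟨i, rfl⟩
  have : φ (X i) = 0 := hmP hX
  exact hi (by simpa [φ] using this)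

/-- If a homogeneous system `y` has only the origin as common zero, then the quotient by part of
the system is a finite module over the polynomial ring acting through the remaining members. -/
theorem finite_of_idealOfVars_le_radical [Finite σ] {ι₁ ι₂ : Type*} [Fintype ι₁] [Fintype ι₂]
    {y : ι₁ ⊕ ι₂ → MvPolynomial σ K} {e : ι₁ ⊕ ι₂ → ℕ} (hy : ∀ j, (y j).IsHomogeneous (e j))
    (he : ∀ j, 0 < e j) (h : idealOfVars σ K ≤ (Ideal.span (Set.range y)).radical)
    {A : Type*} [CommRing A] [Algebra K A] [Algebra (MvPolynomial ι₂ K) A]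
    [IsScalarTower K (MvPolynomial ι₂ K) A] (π : MvPolynomial σ K →ₐ[K] A)
    (hπ : Function.Surjective π) (hπ₁ : ∀ j, π (y (Sum.inl j)) = 0)
    (hπ₂ : ∀ j, π (y (Sum.inr j)) = algebraMap (MvPolynomial ι₂ K) A (X j)) :
    Module.Finite (MvPolynomial ι₂ K) A := by
  obtain ⟨N, hN⟩ := Ideal.exists_pow_le_of_le_radical_of_fg h (idealOfVars_fg σ K)
  choose G hG using fun d => homogeneousSubmodule_fg (R := K) (σ := σ) d
  let B : Set (MvPolynomial σ K) := ⋃ d ∈ Finset.range N, G d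
  have hB : B.Finite := Set.Finite.biUnion (Finset.finite_toSet _) fun d _ => (G d).finite_toSet
  let M := Submodule.span (MvPolynomial ι₂ K) (π '' B)
  have hM : ∀ D p, IsHomogeneous p D → π p ∈ M := by
    intro D
    induction D using Nat.strong_induction_on with
    | _ D ih =>
      intro p hp
      by_cases hD : D < N
      · rw [← mem_homogeneousSubmodule, ← hG D] at hp
        induction hp using Submodule.span_induction with
        | mem x hx =>
          exact Submodule.subset_span ⟨x, Set.mem_biUnion (Finset.mem_range.mpr hD) hx, rfl⟩
        | zero => simp
        | add x y _ _ hx hy => rw [map_add]; exact add_mem hx hy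
        | smul c x _ hx =>
          rw [map_smul, ← algebraMap_smul (MvPolynomial ι₂ K) c (π x)]
          exact M.smul_mem _ hx
      · have hpN : p ∈ Ideal.span (Set.range y) := hN <| by
          rw [mem_pow_idealOfVars_iff']
          intro x hx
          exact hp.coeff_eq_zero (by omega)
        obtain ⟨c, rfl, hc⟩ := hp.exists_isHomogeneous_coeff hy hpN
        rw [map_sum]
        refine sum_mem fun j _ => ?_
        obtain hj | ⟨m, hm, hmj⟩ := hc j
        · simp [hj]
        · rw [map_mul]
          cases j with
          | inl j => simp [hπ₁]
          | inr j =>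
            rw [mul_comm, hπ₂, ← Algebra.smul_def]
            exact M.smul_mem _ (ih m (by have := he (Sum.inr j); omega) _ hmj)
  refine ⟨Submodule.fg_def.mpr ⟨π '' B, hB.image _, ?_⟩⟩
  rw [eq_top_iff]
  rintro a -
  obtain ⟨p, rfl⟩ := hπ a
  rw [← sum_homogeneousComponent p, map_sum]
  exact sum_mem fun d _ => hM d _ (homogeneousComponent_isHomogeneous d p)

theorem ringKrullDim_quotient_le_card [Finite σ] {ι₁ ι₂ : Type*} [Fintype ι₁] [Fintype ι₂]
    {y : ι₁ ⊕ ι₂ → MvPolynomial σ K} {e : ι₁ ⊕ ι₂ → ℕ} (hy : ∀ j, (y j).IsHomogeneous (e j))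
    (he : ∀ j, 0 < e j) (h : idealOfVars σ K ≤ (Ideal.span (Set.range y)).radical) :
    ringKrullDim (MvPolynomial σ K ⧸ Ideal.span (Set.range (y ∘ Sum.inl))) ≤
      Fintype.card ι₂ := by
  generalize hI : Ideal.span (Set.range (y ∘ Sum.inl)) = I
  let π := Ideal.Quotient.mkₐ K I
  let φ : MvPolynomial ι₂ K →ₐ[K] MvPolynomial σ K ⧸ I := aeval fun j => π (y (Sum.inr j))
  let := φ.toRingHom.toAlgebra
  have : IsScalarTower K (MvPolynomial ι₂ K) (MvPolynomial σ K ⧸ I) :=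
    IsScalarTower.of_algebraMap_eq fun c => (φ.commutes c).symm
  have := finite_of_idealOfVars_le_radical hy he h π (Ideal.Quotient.mkₐ_surjective K I)
    (fun j => Ideal.Quotient.eq_zero_iff_mem.mpr (hI ▸ Ideal.subset_span ⟨j, rfl⟩))
    fun j => (aeval_X (fun j => π (y (Sum.inr j))) j).symm
  refine (ringKrullDim_le_of_isIntegral (R := MvPolynomial ι₂ K)).trans ?_
  rw [ringKrullDim_of_isNoetherianRing, ringKrullDim_eq_zero_of_field, zero_add,
    Nat.card_eq_fintype_card]

theorem ringKrullDim_quotient_span_range_comp_inl_le [Finite σ] [IsAlgClosed K]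
    {ι₁ ι₂ : Type*} [Fintype ι₁] [Fintype ι₂]
    {y : ι₁ ⊕ ι₂ → MvPolynomial σ K} {e : ι₁ ⊕ ι₂ → ℕ} (hy : ∀ j, (y j).IsHomogeneous (e j))
    (he : ∀ j, 0 < e j) {d : ℕ}
    (h : ringKrullDim (MvPolynomial σ K ⧸ Ideal.span (Set.range y)) ≤ d) :
    ringKrullDim (MvPolynomial σ K ⧸ Ideal.span (Set.range (y ∘ Sum.inl))) ≤
      (Fintype.card ι₂ + d : ℕ) := by
  have : Infinite K := IsAlgClosed.instInfinite
  obtain ⟨l, hl, hd⟩ := exists_linearForms_ringKrullDim_quotient_nonpos h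
  let z : ι₁ ⊕ (ι₂ ⊕ Fin d) → MvPolynomial σ K :=
    Sum.elim y l ∘ (Equiv.sumAssoc ι₁ ι₂ (Fin d)).symm
  let e' : ι₁ ⊕ (ι₂ ⊕ Fin d) → ℕ :=
    Sum.elim e 1 ∘ (Equiv.sumAssoc ι₁ ι₂ (Fin d)).symm
  have hz : ∀ j, (z j).IsHomogeneous (e' j) := by
    rintro (j | j | j)
    exacts [hy _, hy _, hl _]
  have he' : ∀ j, 0 < e' j := by
    rintro (j | j | j)
    exacts [he _, he _, one_pos]
  have hzr : Set.range z = Set.range y ∪ Set.range l := by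
    rw [EquivLike.range_comp, Set.Sum.elim_range]
  have := ringKrullDim_quotient_le_card hz he' <|
    idealOfVars_le_radical_of_ringKrullDim_nonpos
      (by rintro _ ⟨j, rfl⟩; exact ⟨_, he' j, hz j⟩) (by rwa [hzr, Ideal.span_union])
  rw [Fintype.card_sum, Fintype.card_fin] at this
  exact this

end Field

theorem _root_.Matrix.rank_lt_card_of_det_eq_zero {K n : Type*} [Field K] [Fintype n]
    [DecidableEq n] {A : Matrix n n K} (h : A.det = 0) : A.rank < Fintype.card n := by
  refine A.rank_le_card_width.lt_of_ne fun hr => ?_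
  have hA : IsUnit A := Matrix.linearIndependent_rows_iff_isUnit.mp <|
    linearIndependent_iff_card_eq_finrank_span.mpr (hr.symm.trans A.rank_eq_finrank_span_row)
  exact not_isUnit_zero (h ▸ (Matrix.isUnit_iff_isUnit_det A).mp hA)

section Minors
variable {σ K : Type*} [Field K] {ι : Type*} [Fintype ι]

theorem map_pderiv_sum_mul {A : Type*} [CommRing A] (φ : MvPolynomial σ K →+* A)
    {h g : ι → MvPolynomial σ K} (hg : ∀ j, φ (g j) = 0) (c : σ) :
    φ (pderiv c (∑ j, h j * g j)) = ∑ j, φ (h j) * φ (pderiv c (g j)) := by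
  simp only [map_sum, Derivation.leibniz, smul_eq_mul, map_add, map_mul, hg, zero_mul, add_zero]

theorem det_pderiv_mem_span [DecidableEq ι] {H : Matrix ι ι (MvPolynomial σ K)}
    {f g : ι → MvPolynomial σ K} (hf : ∀ l, f l = ∑ j, H l j * g j) (c : ι → σ) :
    (Matrix.of fun l l' => pderiv (c l') (f l)).det ∈
      Ideal.span (insert H.det (Set.range g)) := by
  rw [← Ideal.Quotient.eq_zero_iff_mem]
  set φ := Ideal.Quotient.mk (Ideal.span (insert H.det (Set.range g)))
  have hg : ∀ j, φ (g j) = 0 := fun j =>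
    Ideal.Quotient.eq_zero_iff_mem.mpr (Ideal.subset_span (Or.inr ⟨j, rfl⟩))
  have hH : φ H.det = 0 := Ideal.Quotient.eq_zero_iff_mem.mpr (Ideal.subset_span (Or.inl rfl))
  have : φ.mapMatrix (Matrix.of fun l l' => pderiv (c l') (f l)) =
      φ.mapMatrix H * φ.mapMatrix (Matrix.of fun j l' => pderiv (c l') (g j)) := by
    ext l l'
    rw [RingHom.mapMatrix_apply, Matrix.map_apply, Matrix.of_apply, hf l, map_pderiv_sum_mul φ hg,
      Matrix.mul_apply]
    rfl
  rw [RingHom.map_det, this, Matrix.det_mul, ← RingHom.map_det, hH, zero_mul]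

theorem eq_of_constantCoeff_det_ne_zero {n : ℕ} {H : Matrix (Fin n) (Fin n) (MvPolynomial σ K)}
    {a b : Fin n → ℕ} (ha : Monotone a) (hb : Monotone b)
    (hH : ∀ l j, H l j = 0 ∨ ∃ m, m + b j = a l ∧ (H l j).IsHomogeneous m)
    (hdet : constantCoeff H.det ≠ 0) : a = b := by
  rw [RingHom.map_det, Matrix.det_apply] at hdet
  obtain ⟨s, -, hs⟩ := Finset.exists_ne_zero_of_sum_ne_zero hdet
  have hs : ∀ j, a (s j) = b j := fun j => by
    have hj : constantCoeff (H (s j) j) ≠ 0 := fun h0 => hs <| by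
      rw [Finset.prod_eq_zero (Finset.mem_univ j) (by simpa using h0), smul_zero]
    obtain h | ⟨m, hm, hmj⟩ := hH (s j) j
    · simp [h] at hj
    · obtain rfl | hm0 := Nat.eq_zero_or_pos m
      · simpa using hm.symm
      · exact absurd (mem_idealOfVars_iff.mp (hmj.mem_idealOfVars hm0)) hj
  have := Tuple.unique_monotone (f := a) (σ := s) (τ := 1)
    (by rwa [show a ∘ s = b from _root_.funext hs]) (by simpa using ha)
  rw [← show a ∘ s = b from _root_.funext hs]
  simpa using this.symm

theorem card_le_ringKrullDim_quotient_span_add [Finite σ] [IsAlgClosed K]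
    {s : Set (MvPolynomial σ K)} (hs : s ⊆ idealOfVars σ K) {m : ℕ} (hm : s.encard ≤ m) :
    (Nat.card σ : WithBot ℕ∞) ≤ ringKrullDim (MvPolynomial σ K ⧸ Ideal.span s) + m := by
  have := Ideal.height_le_ringKrullDim_quotient_add_encard (p := idealOfVars σ K) s hs
  rw [height_idealOfVars] at this
  refine this.trans ?_
  gcongr
  exact_mod_cast hm

end Minors

end MvPolynomial

theorem Set.image_Icc_one_eq_range {α : Type*} (f : ℕ → α) (n : ℕ) :
    f '' Set.Icc 1 n = Set.range fun l : Fin n => f (l + 1) := by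
  ext y
  simp only [Set.mem_image, Set.mem_Icc, Set.mem_range]
  constructor
  · rintro ⟨j, ⟨h1, h2⟩, rfl⟩
    exact ⟨⟨j - 1, by omega⟩, by simp [Nat.sub_add_cancel h1]⟩
  · rintro ⟨l, rfl⟩
    exact ⟨l + 1, ⟨by omega, l.2⟩, rfl⟩

section Jacobian
variable {n m : ℕ} {f g : ℕ → MvPolynomial (Fin (n + 1)) ℂ}
  {H : Matrix (Fin m) (Fin m) (MvPolynomial (Fin (n + 1)) ℂ)}

theorem singularIdeal_le_span (hf : ∀ l : Fin m, f (l + 1) = ∑ j, H l j * g (j + 1)) :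
    singularIdeal n m f ≤
      Ideal.span (insert H.det (Set.range fun j : Fin m => g (j + 1))) := by
  rw [singularIdeal, Set.image_Icc_one_eq_range, Ideal.span_le]
  rintro _ (⟨l, rfl⟩ | ⟨c, rfl⟩)
  · simp only [hf l]
    exact sum_mem fun j _ => Ideal.mul_mem_left _ _ (Ideal.subset_span (Or.inr ⟨j, rfl⟩))
  · exact det_pderiv_mem_span hf c

theorem singularConePt_of_eval_det_eq_zero
    (hf : ∀ l : Fin m, f (l + 1) = ∑ j, H l j * g (j + 1)) {x : Fin (n + 1) → ℂ} (hx : x ≠ 0)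
    (hg : ∀ j : Fin m, eval x (g (j + 1)) = 0) (hH : eval x H.det = 0) :
    SingularConePt n m f x := by
  refine ⟨hx, fun l hl hlm => ?_, ?_⟩
  · have := hf ⟨l - 1, by omega⟩
    simp only [Nat.sub_add_cancel hl] at this
    simp [this, hg]
  · have : jacobianAt n m f x = (eval x).mapMatrix H * jacobianAt n m g x := by
      ext l c
      rw [jacobianAt, Matrix.of_apply, hf l, map_pderiv_sum_mul (eval x) hg, Matrix.mul_apply]
      rfl
    rw [this]
    refine (Matrix.rank_mul_le_left _ _).trans_lt ?_
    rw [RingHom.map_det] at hH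
    simpa using Matrix.rank_lt_card_of_det_eq_zero hH

theorem not_smoothInCodimThree_of_constantCoeff_det_eq_zero
    (hf : ∀ l : Fin m, f (l + 1) = ∑ j, H l j * g (j + 1))
    (hg : ∀ j : Fin m, constantCoeff (g (j + 1)) = 0) (hH : constantCoeff H.det = 0)
    (hdim : ringKrullDim (MvPolynomial (Fin (n + 1)) ℂ ⧸
      Ideal.span ((fun i => f i) '' Set.Icc 1 m)) ≤ (n + 1 - m : ℕ)) (hmn : m ≤ n + 1) :
    ¬ SmoothInCodimThree n m f := by
  intro h
  have hs : (insert H.det (Set.range fun j : Fin m => g (j + 1))) ⊆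
      (idealOfVars (Fin (n + 1)) ℂ : Set _) := by
    rintro _ (rfl | ⟨j, rfl⟩)
    exacts [mem_idealOfVars_iff.mpr hH, mem_idealOfVars_iff.mpr (hg j)]
  have hc : (insert H.det (Set.range fun j : Fin m => g (j + 1))).encard ≤ (m + 1 : ℕ) := by
    refine (Set.encard_insert_le _ _).trans ?_
    rw [← Set.image_univ, Nat.cast_add, Nat.cast_one]
    gcongr
    exact (Set.encard_image_le _ _).trans (by simp)
  have h1 := card_le_ringKrullDim_quotient_span_add hs hc
  have h2 := ringKrullDim_le_of_surjective _
    (Ideal.Quotient.factor_surjective (singularIdeal_le_span hf))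
  have h3 := h.trans hdim
  rw [Nat.card_eq_fintype_card, Fintype.card_fin] at h1
  have h4 : ((n + 1 : ℕ) : WithBot ℕ∞) + 4 ≤ ((n + 1 - m : ℕ) : WithBot ℕ∞) + (m + 1 : ℕ) := calc
    _ ≤ _ := add_le_add_left (h1.trans (add_le_add_left h2 _)) 4
    _ = _ := add_right_comm _ _ _
    _ ≤ _ := add_le_add_left h3 _
  have : n + 1 + 4 ≤ n + 1 - m + (m + 1) := by exact_mod_cast h4
  omega

theorem infinite_projSingularLocus_of_constantCoeff_det_eq_zero
    (hf : ∀ l : Fin m, f (l + 1) = ∑ j, H l j * g (j + 1))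
    (hg : ∀ j : Fin m, constantCoeff (g (j + 1)) = 0) (hH : constantCoeff H.det = 0)
    (hmn : m + 2 ≤ n) : (projSingularLocus n m f).Infinite := by
  intro hfin
  obtain ⟨l, hl, hlT⟩ := exists_linearForm_notMem
    (hfin.image fun P => vanishingIdeal ℂ {P.rep}) (by
      rintro _ ⟨P, -, rfl⟩ hP
      refine P.rep_nonzero (_root_.funext fun i => ?_)
      simpa using hP (Ideal.subset_span ⟨i, rfl⟩ : X i ∈ idealOfVars _ ℂ))
  set s := insert l (insert H.det (Set.range fun j : Fin m => g (j + 1)))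
  have hs : s ⊆ (idealOfVars (Fin (n + 1)) ℂ : Set _) := by
    rintro _ (rfl | rfl | ⟨j, rfl⟩)
    exacts [hl.mem_idealOfVars one_pos, mem_idealOfVars_iff.mpr hH, mem_idealOfVars_iff.mpr (hg j)]
  have hc : s.encard ≤ (m + 2 : ℕ) := by
    refine (Set.encard_insert_le _ _).trans
      ((add_le_add_left (Set.encard_insert_le _ _) 1).trans ?_)
    rw [← Set.image_univ, add_assoc, one_add_one_eq_two, Nat.cast_add, Nat.cast_ofNat]
    gcongr
    exact (Set.encard_image_le _ _).trans (by simp)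
  have h1 := card_le_ringKrullDim_quotient_span_add hs hc
  have h2 : ringKrullDim (MvPolynomial (Fin (n + 1)) ℂ ⧸ Ideal.span s) ≤ 0 := by
    refine ringKrullDim_quotient_nonpos (idealOfVars_le_radical fun x hx => ?_)
    by_contra hx0
    have hxs : ∀ p ∈ s, eval x p = 0 := fun p hp => hx p (Ideal.subset_span hp)
    have hsing := singularConePt_of_eval_det_eq_zero hf hx0
      (fun j => hxs _ (Or.inr (Or.inr ⟨j, rfl⟩))) (hxs _ (Or.inr (Or.inl rfl)))
    refine hlT _ ⟨_, ⟨x, hx0, hsing, rfl⟩, rfl⟩ ?_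
    obtain ⟨a, ha⟩ := Projectivization.exists_smul_eq_mk_rep ℂ x hx0
    simp only [mem_vanishingIdeal_singleton_iff]
    rw [← ha]
    change eval ((a : ℂ) • x) l = 0
    rw [hl.eval_smul, hxs l (Or.inl rfl), mul_zero]
  rw [Nat.card_eq_fintype_card, Fintype.card_fin] at h1
  have h4 : ((n + 1 : ℕ) : WithBot ℕ∞) ≤ 0 + (m + 2 : ℕ) := h1.trans (add_le_add_left h2 _)
  have : n + 1 ≤ 0 + (m + 2) := by exact_mod_cast h4
  omega

end Jacobian

theorem stmt_12 (k : ℕ) (hk : 1 ≤ k)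
    (f g : ℕ → MvPolynomial (Fin (k + 4)) ℂ) (df dg : ℕ → ℕ)
    (hf0 : ∀ i, 1 ≤ i → i ≤ k → f i ≠ 0)
    (hg0 : ∀ j, 1 ≤ j → j ≤ k + 1 → g j ≠ 0)
    (hfh : ∀ i, 1 ≤ i → i ≤ k → (f i).IsHomogeneous (df i))
    (hgh : ∀ j, 1 ≤ j → j ≤ k + 1 → (g j).IsHomogeneous (dg j))
    (hdfpos : ∀ i, 1 ≤ i → i ≤ k → 0 < df i)
    (hdgpos : ∀ j, 1 ≤ j → j ≤ k + 1 → 0 < dg j)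
    (hdfmono : ∀ i j, 1 ≤ i → i ≤ j → j ≤ k → df i ≤ df j)
    (hdgmono : ∀ i j, 1 ≤ i → i ≤ j → j ≤ k + 1 → dg i ≤ dg j)
    -- (i) ⟨f_1,…,f_k⟩ ⊆ ⟨g_1,…,g_{k+1}⟩
    (hsub : Ideal.span (f '' Set.Icc 1 k) ≤ Ideal.span (g '' Set.Icc 1 (k + 1)))
    -- (ii) X = V(f_1,…,f_k) has dimension 3 and finitely many singular points
    (hXdim : ringKrullDim
        (MvPolynomial (Fin (k + 4)) ℂ ⧸ Ideal.span (f '' Set.Icc 1 k)) = 4)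
    (hXsing : (projSingularLocus (k + 3) k f).Finite)
    -- (iii) S = V(g_1,…,g_{k+1}) is a smooth surface
    (hSdim : ringKrullDim
        (MvPolynomial (Fin (k + 4)) ℂ ⧸ Ideal.span (g '' Set.Icc 1 (k + 1))) = 3)
    (hSsmooth : ∀ x : Fin (k + 4) → ℂ, x ≠ 0 →
      (∀ j, 1 ≤ j → j ≤ k + 1 → eval x (g j) = 0) →
      (jacobianAt (k + 3) (k + 1) g x).rank = k + 1)
    -- (iv) V(f_1,…,f_s) is smooth in codimension 3 for every s ≤ k−1
    (hcodim : ∀ s, 1 ≤ s → s ≤ k - 1 → SmoothInCodimThree (k + 3) s f)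
    (i : ℕ) (hi1 : 1 ≤ i) (hik : i ≤ k) (hlt : df i < dg (i + 1)) :
    ∀ j, 1 ≤ j → j ≤ i → df j = dg j := by
  have hcoeff : ∀ l : Fin i, ∃ c : Fin i → MvPolynomial (Fin (k + 4)) ℂ,
      f (l + 1) = ∑ j, c j * g (j + 1) ∧
        ∀ j, c j = 0 ∨ ∃ m, m + dg (j + 1) = df (l + 1) ∧ (c j).IsHomogeneous m := fun l => by
    have hl : f (l + 1) ∈ Ideal.span (Set.range fun j : Fin (k + 1) => g (j + 1)) := by
      rw [← Set.image_Icc_one_eq_range]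
      exact hsub (Ideal.subset_span ⟨l + 1, ⟨by omega, by omega⟩, rfl⟩)
    obtain ⟨c, hc, hc'⟩ := (hfh (l + 1) (by omega) (by omega)).exists_isHomogeneous_coeff
      (fun j : Fin (k + 1) => hgh (j + 1) (by omega) (by omega)) hl
    refine ⟨c ∘ Fin.castLE (by omega), ?_, fun j => hc' _⟩
    rw [hc]
    refine (Fintype.sum_of_injective (Fin.castLE (by omega : i ≤ k + 1))
      (Fin.castLE_injective _) _ _ (fun j hj => ?_) fun j => rfl).symm
    have hij : i ≤ j := by
      by_contra! h
      exact hj ⟨⟨j, h⟩, rfl⟩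
    obtain h | ⟨m, hm, -⟩ := hc' j
    · rw [h, zero_mul]
    · have h1 := hdgmono (i + 1) (j + 1) (by omega) (by omega) (by omega)
      have h2 := hdfmono (l + 1) i (by omega) l.2 hik
      omega
  choose H hH hHdeg using hcoeff
  have hgc : ∀ j : Fin i, constantCoeff (g (j + 1)) = 0 := fun j => mem_idealOfVars_iff.mp <|
    (hgh (j + 1) (by omega) (by omega)).mem_idealOfVars (hdgpos (j + 1) (by omega) (by omega))
  by_cases hdet : constantCoeff (Matrix.det H) = 0
  · exfalso
    obtain rfl | hik := hik.eq_or_lt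
    · exact infinite_projSingularLocus_of_constantCoeff_det_eq_zero hH hgc hdet (by omega) hXsing
    · refine not_smoothInCodimThree_of_constantCoeff_det_eq_zero hH hgc hdet ?_ (by omega)
        (hcodim i hi1 (by omega))
      let v : Fin i ⊕ Fin (k - i) → ℕ := Sum.elim (fun l => l + 1) fun l => i + l + 1
      have hv : ∀ l, 1 ≤ v l ∧ v l ≤ k := by
        rintro (l | l) <;> simp only [v, Sum.elim_inl, Sum.elim_inr] <;> omega
      have hvr : Set.range v = Set.Icc 1 k := by
        ext j
        refine ⟨fun ⟨l, hl⟩ => hl ▸ hv l, fun ⟨h1, h2⟩ => ?_⟩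
        by_cases hj : j ≤ i
        · exact ⟨Sum.inl ⟨j - 1, by omega⟩, by simp only [v, Sum.elim_inl]; omega⟩
        · exact ⟨Sum.inr ⟨j - i - 1, by omega⟩, by simp only [v, Sum.elim_inr]; omega⟩
      have := ringKrullDim_quotient_span_range_comp_inl_le (d := 4) (y := f ∘ v)
        (fun l => hfh _ (hv l).1 (hv l).2) (fun l => hdfpos _ (hv l).1 (hv l).2)
        (by rw [Set.range_comp, hvr, hXdim]; rfl)
      rw [Fintype.card_fin] at this
      rw [Set.image_Icc_one_eq_range, show k + 3 + 1 - i = k - i + 4 by omega]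
      exact this
  · have := eq_of_constantCoeff_det_ne_zero (a := fun l : Fin i => df (l + 1))
      (b := fun l : Fin i => dg (l + 1))
      (fun l l' h => hdfmono _ _ (by omega) (Nat.succ_le_succ h) (by omega))
      (fun l l' h => hdgmono _ _ (by omega) (Nat.succ_le_succ h) (by omega)) hHdeg hdet
    intro j hj1 hji
    simpa [Nat.sub_add_cancel hj1] using congr_fun this ⟨j - 1, by omega⟩
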